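/- arXiv:2205.12480 — 6 statements merged into one kernel-verified Lean document; each statement's English description precedes it below -/
import Mathlib

section
/- Let n ≥ 1 and let T be a torsion array on Fin n satisfying the quadratic identity: for all indices i, j, k, l, one has Σ_r ( T(j,r,k)·T(r,i,l) + T(j,i,r)·T(r,k,l) − T(r,i,k)·T(j,r,l) ) = 0 (sum over r). Then the trace η(i) = Σ_k T(k,k,i) satisfies Σ_r η(r)·T(r,i,k) = 0 for all i, k. -/
/-- For a torsion array `T` on `Fin n` (antisymmetric in its lower
indices) satisfying the quadratic STP identity, the trace `η(i) = Σ_k T(k,k,i)`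
satisfies `Σ_r η(r)·T(r,i,k) = 0` for all `i, k`. -/
theorem torsion_trace_orthogonal (n : ℕ) (hn : 1 ≤ n)
    (T : Fin n → Fin n → Fin n → ℂ)
    (hanti : ∀ j i k, T j i k = - T j k i)
    (hquad : ∀ i j k l, ∑ r : Fin n,
      (T j r k * T r i l + T j i r * T r k l - T r i k * T j r l) = 0)
    (η : Fin n → ℂ) (hη : ∀ i, η i = ∑ k : Fin n, T k k i) :
    ∀ i k, ∑ r : Fin n, η r * T r i k = 0 := by
  intro i k
  have h : ∑ j : Fin n, ∑ r : Fin n,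
      (T j r k * T r i j + T j i r * T r k j - T r i k * T j r j) = 0 :=
    Finset.sum_eq_zero fun j _ => hquad i j k j
  simp only [Finset.sum_add_distrib, Finset.sum_sub_distrib] at h
  have h1 : ∑ j : Fin n, ∑ r : Fin n, T j r k * T r i j
      = - ∑ j : Fin n, ∑ r : Fin n, T j i r * T r k j := by
    rw [Finset.sum_comm, ← Finset.sum_neg_distrib]
    refine Finset.sum_congr rfl fun a _ => ?_
    rw [← Finset.sum_neg_distrib]
    refine Finset.sum_congr rfl fun b _ => ?_
    rw [hanti b a k]; ring
  have h2 : ∑ j : Fin n, ∑ r : Fin n, T r i k * T j r j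
      = - ∑ r : Fin n, η r * T r i k := by
    rw [Finset.sum_comm, ← Finset.sum_neg_distrib]
    refine Finset.sum_congr rfl fun a _ => ?_
    rw [hη, Finset.sum_mul, ← Finset.sum_neg_distrib]
    refine Finset.sum_congr rfl fun b _ => ?_
    rw [hanti b a b]; ring
  rw [h1, h2] at h
  linear_combination h
end

section
/- Let n ≥ 1 and let T be a torsion array on Fin n satisfying, for all indices i, j, k, l, the identity Σ_r ( T(j,r,k)·T(r,i,l) + T(j,i,r)·T(r,k,l) − T(r,i,k)·T(j,r,l) ) = 0. If the trace η(i) = Σ_k T(k,k,i) is not identically zero, then the matrix B(i,j) = Σ_{r,s} T(j,r,s)·conj(T(i,r,s)) is not positive definite. (This is the algebraic core of the statement that the B tensor of a non-balanced Strominger-torsion-parallel Hermitian manifold can never be positive definite.) -/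
open ComplexOrder

/-- If a torsion array `T` on `Fin n` satisfies the quadratic STP
identity and its trace `η` is not identically zero, then the matrix
`B(i,j) = Σ_{r,s} T(j,r,s)·conj(T(i,r,s))` is not positive definite. -/
theorem stp_nonbalanced_B_not_posDef (n : ℕ) (hn : 1 ≤ n)
    (T : Fin n → Fin n → Fin n → ℂ)
    (hanti : ∀ j i k, T j i k = - T j k i)
    (hquad : ∀ i j k l, ∑ r : Fin n,
      (T j r k * T r i l + T j i r * T r k l - T r i k * T j r l) = 0)
    (η : Fin n → ℂ) (hη : ∀ i, η i = ∑ k : Fin n, T k k i)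
    (hne : η ≠ 0) :
    ¬ (Matrix.of fun i j : Fin n =>
        ∑ r : Fin n, ∑ s : Fin n, T j r s * star (T i r s)).PosDef := by
  have key : ∀ i k, ∑ r : Fin n, T r i k * η r = 0 := by
    intro i k
    have h : ∑ l : Fin n, ∑ r : Fin n,
        (T l r k * T r i l + T l i r * T r k l - T r i k * T l r l) = 0 :=
      Finset.sum_eq_zero fun l _ => hquad i l k l
    simp only [Finset.sum_sub_distrib, Finset.sum_add_distrib] at h
    have h2 : ∑ l : Fin n, ∑ r : Fin n, T l i r * T r k l
        = - ∑ l : Fin n, ∑ r : Fin n, T l r k * T r i l := by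
      rw [Finset.sum_comm, ← Finset.sum_neg_distrib]
      refine Finset.sum_congr rfl fun l _ => ?_
      rw [← Finset.sum_neg_distrib]
      refine Finset.sum_congr rfl fun r _ => ?_
      rw [hanti l k r]
      ring
    have h3 : ∑ l : Fin n, ∑ r : Fin n, T r i k * T l r l
        = - ∑ r : Fin n, T r i k * η r := by
      rw [Finset.sum_comm, ← Finset.sum_neg_distrib]
      refine Finset.sum_congr rfl fun r _ => ?_
      rw [hη r, Finset.mul_sum, ← Finset.sum_neg_distrib]
      refine Finset.sum_congr rfl fun l _ => ?_
      rw [hanti l r l]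
      ring
    rw [h2, h3] at h
    simpa using h
  intro hB
  have hpos := hB.dotProduct_mulVec_pos hne
  have hz : (Matrix.of fun i j : Fin n =>
        ∑ r : Fin n, ∑ s : Fin n, T j r s * star (T i r s)).mulVec η = 0 := by
    funext i
    simp only [Matrix.mulVec, dotProduct, Matrix.of_apply, Pi.zero_apply, Finset.sum_mul]
    rw [Finset.sum_comm]
    refine Finset.sum_eq_zero fun r _ => ?_
    rw [Finset.sum_comm]
    refine Finset.sum_eq_zero fun s _ => ?_
    have := congrArg (fun z => star (T i r s) * z) (key r s)
    simp only [Finset.mul_sum, mul_zero] at this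
    rw [← this]
    refine Finset.sum_congr rfl fun j _ => ?_
    ring
  rw [hz] at hpos
  simp at hpos
end

section
/- Let T be a torsion array on Fin 2 (i.e. n = 2). Then the square norm and the trace satisfy |T|² = 2·Σ_i |η(i)|², where η(i) = Σ_k T(k,k,i) and |T|² = Σ_{i,j,k} |T(j,i,k)|². (This is the identity |T|² = 2|η|² in complex dimension 2, showing that for n = 2 the Chern torsion and Gauduchon's torsion 1-form carry the same information.) -/
/-- For a torsion array `T` on `Fin 2`, the square norm equals
twice the square norm of the trace: `|T|² = 2|η|²`. -/
theorem torsion_dim2_norm (T : Fin 2 → Fin 2 → Fin 2 → ℂ)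
    (hanti : ∀ j i k, T j i k = - T j k i)
    (η : Fin 2 → ℂ) (hη : ∀ i, η i = ∑ k : Fin 2, T k k i) :
    (∑ i : Fin 2, ∑ j : Fin 2, ∑ k : Fin 2, ‖T j i k‖ ^ 2)
      = 2 * ∑ i : Fin 2, ‖η i‖ ^ 2 := by
  have h0 : ∀ j i, T j i i = 0 := fun j i => self_eq_neg.mp (hanti j i i)
  have h1 : ∀ j, T j 1 0 = - T j 0 1 := fun j => hanti j 1 0
  simp only [hη, Fin.sum_univ_two, h0, h1, norm_neg, norm_zero, zero_add, add_zero]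
  ring
end

section
/- Let n ≥ 2, let η : Fin n → ℂ, and define T(j,i,k) = (δ_{ij}·η(k) − δ_{kj}·η(i))/(n−1). Then the matrix A(i,j) = Σ_{r,s} T(r,i,s)·conj(T(r,j,s)) satisfies A(i,j) = ( δ_{ij}·|η|² + (n−2)·η(i)·conj(η(j)) )/(n−1)² for all i, j, where |η|² = Σ_i |η(i)|². -/
/-- For the torsion array
`T(j,i,k) = (δ_{ij}·η(k) − δ_{kj}·η(i))/(n−1)` of a locally conformally Kähler
metric, the matrix `A(i,j) = Σ_{r,s} T(r,i,s)·conj(T(r,j,s))` equals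
`(δ_{ij}·|η|² + (n−2)·η(i)·conj(η(j)))/(n−1)²`. -/
theorem lck_torsion_A (n : ℕ) (hn : 2 ≤ n) (η : Fin n → ℂ)
    (T : Fin n → Fin n → Fin n → ℂ)
    (hT : ∀ j i k, T j i k =
      ((if i = j then (1:ℂ) else 0) * η k - (if k = j then (1:ℂ) else 0) * η i)
        / ((n : ℂ) - 1)) :
    ∀ i j : Fin n,
      (∑ r : Fin n, ∑ s : Fin n, T r i s * star (T r j s))
        = ((if i = j then (1:ℂ) else 0)
              * ((∑ m : Fin n, ‖η m‖ ^ 2 : ℝ) : ℂ)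
            + ((n : ℂ) - 2) * η i * star (η j)) / ((n : ℂ) - 1) ^ 2 := by
  intro i j
  have key : ∀ r s : Fin n, T r i s * star (T r j s) =
      ((if i = r then (if j = r then η s * star (η s) else 0) else 0)
        - (if i = r then (if s = r then η s * star (η j) else 0) else 0)
        - (if j = r then (if s = r then η i * star (η s) else 0) else 0)
        + (if s = r then η i * star (η j) else 0)) / ((n : ℂ) - 1) ^ 2 := by
    intro r s
    have hs : star (T r j s) =
      ((if j = r then (1:ℂ) else 0) * star (η s) - (if s = r then (1:ℂ) else 0) * star (η j))
        / ((n : ℂ) - 1) := by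
      rw [hT]
      split_ifs <;> simp
    rw [hs, hT, div_mul_div_comm, ← pow_two]
    congr 1
    split_ifs <;> ring
  have hnorm : ((∑ m : Fin n, ‖η m‖ ^ 2 : ℝ) : ℂ) = ∑ m : Fin n, η m * star (η m) := by
    push_cast
    refine Finset.sum_congr rfl fun m _ => ?_
    exact (Complex.mul_conj' (η m)).symm
  have h1 : ∑ r : Fin n, ∑ s : Fin n,
      (if i = r then (if j = r then η s * star (η s) else 0) else 0)
      = (if i = j then (1:ℂ) else 0) * ∑ m : Fin n, η m * star (η m) := by
    rw [Finset.sum_eq_single i]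
    · by_cases h : i = j
      · simp [h]
      · simp [h, Ne.symm h]
    · intro b _ hb
      simp [Ne.symm hb]
    · simp
  have h2 : ∑ r : Fin n, ∑ s : Fin n,
      (if i = r then (if s = r then η s * star (η j) else 0) else 0)
      = η i * star (η j) := by
    rw [Finset.sum_comm]; simp
  have h3 : ∑ r : Fin n, ∑ s : Fin n,
      (if j = r then (if s = r then η i * star (η s) else 0) else 0)
      = η i * star (η j) := by
    rw [Finset.sum_comm]; simp
  have h4 : ∑ r : Fin n, ∑ s : Fin n, (if s = r then η i * star (η j) else 0)
      = n * (η i * star (η j)) := by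
    simp
  simp only [key, ← Finset.sum_div, Finset.sum_add_distrib, Finset.sum_sub_distrib]
  rw [h1, h2, h3, h4, hnorm]
  congr 1
  ring
end

section
/- Let n ≥ 2 and let C, D : Fin n → Fin n → Fin n → ℂ be families of complex numbers, written C(j,i,k) for C^j_{ik} and D(i,j,k) for D^i_{jk}, such that C is antisymmetric in its last two indices (C(j,i,k) = −C(j,k,i)) and the nilpotency conditions hold: C(j,i,k) = 0 unless j > i and j > k, and D(i,j,k) = 0 unless j > i and j > k (indices compared as elements of {1,…,n}). Define T(j,i,k) = −C(j,i,k) − D(j,i,k) + D(j,k,i), η(r) = Σ_s D(s,r,s), φ(i,j) = Σ_r T(j,i,r)·conj(η(r)), and ξ(i,j) = Σ_{k,r} ( T(j,r,k)·conj(D(i,r,k)) + T(j,i,r)·conj(D(k,r,k)) − T(r,i,k)·conj(D(r,j,k)) ). Then, writing n for the largest index: A(n,n) = Σ_{r,s} |D(r,n,s)|², B(n,n) = Σ_{r,s} |C(n,r,s)|², and φ(n,n) − ξ(n,n) = −Σ_{r,s} |D(r,n,s)|², where A(i,j) = Σ_{r,s} T(r,i,s)·conj(T(r,j,s)) and B(i,j)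 = Σ_{r,s} T(j,r,s)·conj(T(i,r,s)). -/
/-- For the structure constants `C, D` of a complex nilmanifold
with nilpotent `J` in Salamon's normal form (nonzero only when the dominant
index exceeds the others), with Chern torsion
`T(j,i,k) = −C(j,i,k) − D(j,i,k) + D(j,k,i)`, torsion one-form
`η(r) = Σ_s D(s,r,s)`, and `φ, ξ` as in the paper, writing `N` for the largest
index one has `A(N,N) = Σ_{r,s}|D(r,N,s)|²`, `B(N,N) = Σ_{r,s}|C(N,r,s)|²`,
and `φ(N,N) − ξ(N,N) = −Σ_{r,s}|D(r,N,s)|²`. -/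
theorem nilmanifold_nn_entries (n : ℕ) (hn : 2 ≤ n)
    (C D : Fin n → Fin n → Fin n → ℂ)
    (hCanti : ∀ j i k, C j i k = - C j k i)
    (hC0 : ∀ j i k : Fin n, ¬ (i < j ∧ k < j) → C j i k = 0)
    (hD0 : ∀ i j k : Fin n, ¬ (i < j ∧ k < j) → D i j k = 0)
    (T : Fin n → Fin n → Fin n → ℂ)
    (hT : ∀ j i k, T j i k = - C j i k - D j i k + D j k i)
    (η : Fin n → ℂ) (hη : ∀ r, η r = ∑ s : Fin n, D s r s)
    (φ ξ : Fin n → Fin n → ℂ)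
    (hφ : ∀ i j, φ i j = ∑ r : Fin n, T j i r * star (η r))
    (hξ : ∀ i j, ξ i j = ∑ k : Fin n, ∑ r : Fin n,
      (T j r k * star (D i r k) + T j i r * star (D k r k)
        - T r i k * star (D r j k)))
    (N : Fin n) (hN : (N : ℕ) = n - 1) :
    (∑ r : Fin n, ∑ s : Fin n, T r N s * star (T r N s))
        = ((∑ r : Fin n, ∑ s : Fin n, ‖D r N s‖ ^ 2 : ℝ) : ℂ) ∧
    (∑ r : Fin n, ∑ s : Fin n, T N r s * star (T N r s))
        = ((∑ r : Fin n, ∑ s : Fin n, ‖C N r s‖ ^ 2 : ℝ) : ℂ) ∧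
    φ N N - ξ N N
        = -((∑ r : Fin n, ∑ s : Fin n, ‖D r N s‖ ^ 2 : ℝ) : ℂ) := by
  have hle : ∀ r : Fin n, ¬ N < r := by
    intro r h
    have h1 : (N : ℕ) < r := h
    have h2 := r.isLt
    omega
  have hDN : ∀ r s, D N r s = 0 := fun r s => hD0 _ _ _ (fun h => hle _ h.1)
  have hT1 : ∀ r s, T r N s = - D r N s := by
    intro r s
    rw [hT, hC0 r N s (fun h => hle _ h.1), hD0 r s N (fun h => hle _ h.2)]
    ring
  have hT2 : ∀ r s, T N r s = - C N r s := by
    intro r s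
    rw [hT, hDN, hDN]
    ring
  have hT3 : ∀ r, T N N r = 0 := by
    intro r
    rw [hT1, hDN, neg_zero]
  have hsq : ∀ z : ℂ, z * star z = ((‖z‖ ^ 2 : ℝ) : ℂ) := by
    intro z
    have := Complex.mul_conj' z
    push_cast
    exact this
  refine ⟨?_, ?_, ?_⟩
  · simp only [hT1, star_neg, neg_mul_neg, hsq, Complex.ofReal_sum]
  · simp only [hT2, star_neg, neg_mul_neg, hsq, Complex.ofReal_sum]
  · rw [hφ, hξ]
    simp only [hT3, hDN, zero_mul, star_zero, mul_zero, Finset.sum_const_zero, zero_add, zero_sub,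
      hT1, neg_mul, neg_neg, hsq, Complex.ofReal_sum]
    rw [Finset.sum_comm]
end

section
/- Let n ≥ 2 and let C, D : Fin n → Fin n → Fin n → ℂ satisfy the hypotheses: C antisymmetric in its last two indices, and C(j,i,k) = 0 unless j > i and j > k, and D(i,j,k) = 0 unless j > i and j > k. Define T(j,i,k) = −C(j,i,k) − D(j,i,k) + D(j,k,i), η(r) = Σ_s D(s,r,s), φ(i,j) = Σ_r T(j,i,r)·conj(η(r)), ξ(i,j) = Σ_{k,r} ( T(j,r,k)·conj(D(i,r,k)) + T(j,i,r)·conj(D(k,r,k)) − T(r,i,k)·conj(D(r,j,k)) ), A(i,j) = Σ_{r,s} T(r,i,s)·conj(T(r,j,s)), B(i,j) = Σ_{r,s} T(j,r,s)·conj(T(i,r,s)), and |T|² = Σ_{i,j,k} |T(j,i,k)|². If the torsion-critical equation holds at the (n,n) entry, namely 2·A(n,n) − B(n,n) + 2·(φ(n,n) + conj(φ(n,n))) − 2·(ξ(n,n) + conj(ξ(n,n))) = (1/n)·|T|², then T(j,i,k) = 0 for all i, j, k. (This shows a complex nilmanifold with nilpotent J cannot be torsion-critical unless it is Kähler.) 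-/
/-- For a complex nilmanifold with nilpotent `J` in Salamon's
normal form, if the `(N,N)` entry of the torsion-critical Euler–Lagrange
equation holds, namely
`2A(N,N) − B(N,N) + 2(φ(N,N) + conj φ(N,N)) − 2(ξ(N,N) + conj ξ(N,N)) = (1/n)|T|²`,
then the Chern torsion `T` vanishes identically (the metric is Kähler). -/
theorem nilmanifold_torsion_critical_kahler (n : ℕ) (hn : 2 ≤ n)
    (C D : Fin n → Fin n → Fin n → ℂ)
    (hCanti : ∀ j i k, C j i k = - C j k i)
    (hC0 : ∀ j i k : Fin n, ¬ (i < j ∧ k < j) → C j i k = 0)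
    (hD0 : ∀ i j k : Fin n, ¬ (i < j ∧ k < j) → D i j k = 0)
    (T : Fin n → Fin n → Fin n → ℂ)
    (hT : ∀ j i k, T j i k = - C j i k - D j i k + D j k i)
    (η : Fin n → ℂ) (hη : ∀ r, η r = ∑ s : Fin n, D s r s)
    (φ ξ : Fin n → Fin n → ℂ)
    (hφ : ∀ i j, φ i j = ∑ r : Fin n, T j i r * star (η r))
    (hξ : ∀ i j, ξ i j = ∑ k : Fin n, ∑ r : Fin n,
      (T j r k * star (D i r k) + T j i r * star (D k r k)
        - T r i k * star (D r j k)))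
    (A B : Fin n → Fin n → ℂ)
    (hA : ∀ i j, A i j = ∑ r : Fin n, ∑ s : Fin n, T r i s * star (T r j s))
    (hB : ∀ i j, B i j = ∑ r : Fin n, ∑ s : Fin n, T j r s * star (T i r s))
    (N : Fin n) (hN : (N : ℕ) = n - 1)
    (heq : 2 * A N N - B N N + 2 * (φ N N + star (φ N N))
        - 2 * (ξ N N + star (ξ N N))
      = (1 / (n : ℂ)) * ((∑ i : Fin n, ∑ j : Fin n, ∑ k : Fin n,
          ‖T j i k‖ ^ 2 : ℝ) : ℂ)) :
    ∀ j i k, T j i k = 0 := by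
  have hmax : ∀ i : Fin n, ¬ (N < i) := by
    intro i h
    have h1 := i.isLt
    have h2 : (N : ℕ) < (i : ℕ) := h
    omega
  have hDN : ∀ i k, D N i k = 0 := fun i k => hD0 _ _ _ (fun h => hmax _ h.1)
  have hDN' : ∀ i k, D i k N = 0 := fun i k => hD0 _ _ _ (fun h => hmax _ h.2)
  have hTNN : ∀ r, T N N r = 0 := by
    intro r
    rw [hT, hDN, hDN, hC0 _ _ _ (fun h => hmax _ h.1)]
    simp
  have hTr : ∀ r k, D r N k = - T r N k := by
    intro r k
    rw [hT, hDN' r k, hC0 _ _ _ (fun h => hmax _ h.1)]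
    simp
  have hφN : φ N N = 0 := by
    rw [hφ]; simp [hTNN]
  have hmul : ∀ z : ℂ, z * star z = ((‖z‖ ^ 2 : ℝ) : ℂ) := by
    intro z
    have := Complex.mul_conj' z
    push_cast
    exact this
  have hAN : A N N = ((∑ r : Fin n, ∑ s : Fin n, ‖T r N s‖ ^ 2 : ℝ) : ℂ) := by
    rw [hA]; simp only [hmul, Complex.ofReal_sum]
  have hBN : B N N = ((∑ r : Fin n, ∑ s : Fin n, ‖T N r s‖ ^ 2 : ℝ) : ℂ) := by
    rw [hB]; simp only [hmul, Complex.ofReal_sum]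
  have hξN : ξ N N = ((∑ r : Fin n, ∑ s : Fin n, ‖T r N s‖ ^ 2 : ℝ) : ℂ) := by
    rw [← hAN, hξ, hA, Finset.sum_comm]
    refine Finset.sum_congr rfl fun r _ => Finset.sum_congr rfl fun k _ => ?_
    rw [hDN, hTNN, hTr r k, star_neg]
    simp
  rw [hφN, hξN, hAN, hBN] at heq
  have hn0 : (0 : ℝ) < 1 / (n : ℝ) := by
    have : (0 : ℝ) < n := by exact_mod_cast (by omega : 0 < n)
    positivity
  have ha : 0 ≤ ∑ r : Fin n, ∑ s : Fin n, ‖T r N s‖ ^ 2 :=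
    Finset.sum_nonneg fun _ _ => Finset.sum_nonneg fun _ _ => sq_nonneg _
  have hb : 0 ≤ ∑ r : Fin n, ∑ s : Fin n, ‖T N r s‖ ^ 2 :=
    Finset.sum_nonneg fun _ _ => Finset.sum_nonneg fun _ _ => sq_nonneg _
  have hs : 0 ≤ ∑ i : Fin n, ∑ j : Fin n, ∑ k : Fin n, ‖T j i k‖ ^ 2 :=
    Finset.sum_nonneg fun _ _ => Finset.sum_nonneg fun _ _ => Finset.sum_nonneg fun _ _ => sq_nonneg _
  generalize (∑ r : Fin n, ∑ s : Fin n, ‖T r N s‖ ^ 2) = a at heq ha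
  generalize (∑ r : Fin n, ∑ s : Fin n, ‖T N r s‖ ^ 2) = b at heq hb
  have key : ∑ i : Fin n, ∑ j : Fin n, ∑ k : Fin n, ‖T j i k‖ ^ 2 = 0 := by
    generalize (∑ i : Fin n, ∑ j : Fin n, ∑ k : Fin n, ‖T j i k‖ ^ 2) = t at heq hs ⊢
    have h2 : 2 * a - b - 2 * (a + a) = 1 / (n : ℝ) * t := by
      have hst : star (a : ℂ) = (a : ℂ) := Complex.conj_ofReal a
      rw [hst] at heq
      simp only [star_zero, add_zero, mul_zero] at heq
      apply Complex.ofReal_injective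
      push_cast
      exact heq
    by_contra hne
    have : 0 < 1 / (n : ℝ) * t := mul_pos hn0 (lt_of_le_of_ne hs (Ne.symm hne))
    linarith
  intro j i k
  rw [Finset.sum_eq_zero_iff_of_nonneg (fun _ _ => Finset.sum_nonneg fun _ _ => Finset.sum_nonneg fun _ _ => sq_nonneg _)] at key
  have k1 := key i (Finset.mem_univ _)
  rw [Finset.sum_eq_zero_iff_of_nonneg (fun _ _ => Finset.sum_nonneg fun _ _ => sq_nonneg _)] at k1
  have k2 := k1 j (Finset.mem_univ _)
  rw [Finset.sum_eq_zero_iff_of_nonneg (fun _ _ => sq_nonneg _)] at k2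
  have k3 := k2 k (Finset.mem_univ _)
  simpa using k3
end
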